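/- Let α > 0 and let φ : ℂ → ℂ be Lebesgue measurable satisfying condition (I₁) and the Fock BMO bound sup_{z∈ℂ} ∫_ℂ |φ(z − ω) − φ̃_2(z)| dλ_α(ω) < ∞. If the Toeplitz operator T_φ is compact on F_α^∞, then for every t > 0 the t-Berezin transform φ̃_t vanishes at infinity, i.e. φ̃_t(z) → 0 as |z| → ∞. -/

import Mathlib

open MeasureTheory Filter Metric
open scoped ENNReal Topology

/-- The Gaussian weight `e^{-α|z|^2/2}`. -/
noncomputable def gauss (α : ℝ) (z : ℂ) : ℝ := Real.exp (-α * ‖z‖ ^ 2 / 2)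

/-- The Fock norm `‖f‖_{p,α} = [(pα/(2π)) ∫ (|f| e^{-α|z|²/2})^p dA]^{1/p}` (as an `ℝ≥0∞`). -/
noncomputable def fockNormP (α p : ℝ) (f : ℂ → ℂ) : ℝ≥0∞ :=
  (ENNReal.ofReal (p * α / (2 * Real.pi)) *
    ∫⁻ z : ℂ, ENNReal.ofReal ((‖f z‖ * gauss α z) ^ p)) ^ (1 / p)

/-- The Fock sup-norm `‖f‖_{∞,α} = sup_z |f z| e^{-α|z|²/2}` (as an `ℝ≥0∞`). -/
noncomputable def fockNormInf (α : ℝ) (f : ℂ → ℂ) : ℝ≥0∞ :=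
  ⨆ z : ℂ, ENNReal.ofReal (‖f z‖ * gauss α z)

/-- Membership in the Fock space `F_α^p`. -/
def MemFock (α p : ℝ) (f : ℂ → ℂ) : Prop :=
  Differentiable ℂ f ∧ fockNormP α p f ≠ ⊤

/-- Membership in the Fock space `F_α^∞`. -/
def MemFockInf (α : ℝ) (f : ℂ → ℂ) : Prop :=
  Differentiable ℂ f ∧ fockNormInf α f ≠ ⊤

/-- `∫_ℂ (|f(z)| e^{-α|z|²/2})^q dμ(z)` as an `ℝ≥0∞`. -/
noncomputable def carlesonInt (α q : ℝ) (μ : Measure ℂ) (f : ℂ → ℂ) : ℝ≥0∞ :=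
  ∫⁻ z : ℂ, ENNReal.ofReal ((‖f z‖ * gauss α z) ^ q) ∂μ

/-- `μ` is an `(∞,q)` Fock-Carleson measure. -/
def IsInfqCarleson (α q : ℝ) (μ : Measure ℂ) : Prop :=
  ∃ C > (0 : ℝ), ∀ f : ℂ → ℂ, MemFockInf α f →
    (carlesonInt α q μ f) ^ (1 / q) ≤ ENNReal.ofReal C * fockNormInf α f

/-- The `t`-Berezin transform of a measure:
`μ̃_t(z) = (α/π) ∫ e^{-(αt/2)|z-ω|²} dμ(ω)` (as an `ℝ≥0∞`). -/
noncomputable def berezinM (α t : ℝ) (μ : Measure ℂ) (z : ℂ) : ℝ≥0∞ :=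
  ENNReal.ofReal (α / Real.pi) *
    ∫⁻ ω : ℂ, ENNReal.ofReal (Real.exp (-(α * t / 2) * ‖z - ω‖ ^ 2)) ∂μ

/-- Condition (I₁) for a complex symbol:
`(α/π) ∫ |φ(ω)| e^{2α Re(z̄ω)} e^{-α|ω|²} dA(ω) < ∞` for every `z`. -/
def CondI1C (α : ℝ) (φ : ℂ → ℂ) : Prop :=
  ∀ z : ℂ, (∫⁻ ω : ℂ,
    ENNReal.ofReal (‖φ ω‖ *
      Real.exp (2 * α * ((starRingEnd ℂ) z * ω).re - α * ‖ω‖ ^ 2))) < ⊤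

/-- The Toeplitz operator with complex symbol `φ`:
`T_φ f(z) = (α/π) ∫ φ(ω) f(ω) e^{α z ω̄} e^{-α|ω|²} dA(ω)`. -/
noncomputable def toeplitzC (α : ℝ) (φ : ℂ → ℂ) (f : ℂ → ℂ) (z : ℂ) : ℂ :=
  ((α / Real.pi : ℝ) : ℂ) *
    ∫ ω : ℂ, φ ω * f ω *
      Complex.exp ((α : ℂ) * z * (starRingEnd ℂ) ω - ((α * ‖ω‖ ^ 2 : ℝ) : ℂ))

/-- The `t`-Berezin transform of a complex symbol `φ`:
`φ̃_t(z) = (α/π) ∫ φ(ω) e^{-(αt/2)|z-ω|²} dA(ω)`. -/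
noncomputable def berezinC (α t : ℝ) (φ : ℂ → ℂ) (z : ℂ) : ℂ :=
  ((α / Real.pi : ℝ) : ℂ) *
    ∫ ω : ℂ, φ ω * ((Real.exp (-(α * t / 2) * ‖z - ω‖ ^ 2) : ℝ) : ℂ)

/-- The Fock-BMO bound: `sup_z ∫ |φ(z − ω) − φ̃_2(z)| dλ_α(ω) < ∞`. -/
def FockBMOBound (α : ℝ) (φ : ℂ → ℂ) : Prop :=
  ∃ B : ℝ, ∀ z : ℂ, (∫⁻ ω : ℂ,
      ENNReal.ofReal (α / Real.pi * Real.exp (-α * ‖ω‖ ^ 2) *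
        ‖φ (z - ω) - berezinC α 2 φ z‖)) ≤ ENNReal.ofReal B


/-- Normalized reproducing kernel. -/
noncomputable def nker (α : ℝ) (w : ℂ) (ω : ℂ) : ℂ :=
  Complex.exp ((α : ℂ) * (starRingEnd ℂ) w * ω - ((α * ‖w‖ ^ 2 / 2 : ℝ) : ℂ))

/-- Two-parameter Gaussian kernel. -/
noncomputable def kerE (α : ℝ) (a b v : ℂ) : ℂ :=
  Complex.exp ((α : ℂ) * ((starRingEnd ℂ) b * v + a * (starRingEnd ℂ) v) - ((α * ‖v‖ ^ 2 : ℝ) : ℂ))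

lemma norm_kerE (α : ℝ) (a b v : ℂ) :
    ‖kerE α a b v‖ = Real.exp (-α * ‖v - (a + b) / 2‖ ^ 2) * Real.exp (α * ‖(a + b) / 2‖ ^ 2) := by
  unfold kerE
  rw [Complex.norm_exp, ← Real.exp_add]
  congr 1
  simp only [Complex.sq_norm, Complex.normSq_apply]
  simp
  ring

lemma norm_nker_gauss (α : ℝ) (w ω : ℂ) :
    ‖nker α w ω‖ * gauss α ω = Real.exp (-(α / 2) * ‖ω - w‖ ^ 2) := by
  unfold nker gauss
  rw [Complex.norm_exp, ← Real.exp_add]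
  congr 1
  simp only [Complex.sq_norm, Complex.normSq_apply]
  simp
  ring

lemma fockNormInf_nker_le (α : ℝ) (hα : 0 < α) (w : ℂ) : fockNormInf α (nker α w) ≤ ENNReal.ofReal 1 := by
  unfold fockNormInf
  refine iSup_le fun ω => ENNReal.ofReal_le_ofReal ?_
  rw [norm_nker_gauss, Real.exp_le_one_iff]
  have := sq_nonneg ‖ω - w‖
  nlinarith

lemma nker_unif (α : ℝ) (hα : 0 < α) (w : ℕ → ℂ) (hw : Tendsto w atTop (cocompact ℂ)) (K : Set ℂ)
    (hK : IsCompact K) :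
    TendstoUniformlyOn (fun n => nker α (w n)) (fun _ => 0) atTop K := by
  obtain ⟨R, hR⟩ := hK.isBounded.exists_norm_le
  have hn : Tendsto (fun n => ‖w n‖) atTop atTop := tendsto_norm_cocompact_atTop.comp hw
  rw [Metric.tendstoUniformlyOn_iff]
  intro ε hε
  have h1 : Tendsto (fun x : ℝ => Real.exp (-(x * (α / 2 * x - α * R)))) atTop (𝓝 0) := by
    refine Real.tendsto_exp_neg_atTop_nhds_zero.comp ?_
    refine tendsto_id.atTop_mul_atTop₀ ?_
    exact tendsto_atTop_add_const_right _ _ (tendsto_id.const_mul_atTop (by positivity))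
  filter_upwards [(h1.comp hn).eventually_lt_const hε] with n hn ω hω
  rw [dist_zero_left]
  refine lt_of_le_of_lt ?_ hn
  unfold nker
  rw [Complex.norm_exp]
  refine Real.exp_le_exp.2 ?_
  have h2 : ((starRingEnd ℂ) (w n) * ω).re ≤ ‖w n‖ * R := by
    refine (Complex.re_le_norm _).trans ?_
    rw [norm_mul, RCLike.norm_conj]
    exact mul_le_mul_of_nonneg_left (hR ω hω) (norm_nonneg _)
  have h3 : ((α : ℂ) * (starRingEnd ℂ) (w n) * ω - ((α * ‖w n‖ ^ 2 / 2 : ℝ) : ℂ)).re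
      = α * ((starRingEnd ℂ) (w n) * ω).re - α * ‖w n‖ ^ 2 / 2 := by
    rw [Complex.sub_re, mul_assoc, Complex.re_ofReal_mul, Complex.ofReal_re]
  rw [h3]
  have := mul_le_mul_of_nonneg_left h2 hα.le
  simp only
  nlinarith

instance cocompact_cg : (cocompact ℂ).IsCountablyGenerated := by
  rw [← Metric.cobounded_eq_cocompact, ← comap_norm_atTop]
  infer_instance

lemma toeplitz_nker_tendsto (α : ℝ) (hα : 0 < α) (φ : ℂ → ℂ)
    (hcompact : ∀ f : ℕ → ℂ → ℂ, (∀ n, MemFockInf α (f n)) →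
      (∃ M : ℝ, ∀ n, fockNormInf α (f n) ≤ ENNReal.ofReal M) →
      (∀ K : Set ℂ, IsCompact K → TendstoUniformlyOn (fun n => f n) (fun _ => 0) atTop K) →
      Tendsto (fun n => fockNormInf α (toeplitzC α φ (f n))) atTop (𝓝 0)) :
    Tendsto (fun w => fockNormInf α (toeplitzC α φ (nker α w))) (cocompact ℂ) (𝓝 0) := by
  refine tendsto_of_seq_tendsto fun w hw => ?_
  refine hcompact (fun n => nker α (w n)) (fun n => ⟨?_, ?_⟩) ⟨1, fun n => fockNormInf_nker_le α hα _⟩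
    (fun K hK => nker_unif α hα w hw K hK)
  · unfold nker; fun_prop
  · exact ((fockNormInf_nker_le α hα _).trans_lt ENNReal.ofReal_lt_top).ne

lemma toeplitz_eq (α : ℝ) (φ : ℂ → ℂ) (z a b : ℂ) :
    ‖toeplitzC α φ (nker α (z + b)) (z + a)‖ * gauss α (z + a) =
      |α / Real.pi| * Real.exp (-α * (‖a‖ ^ 2 + ‖b‖ ^ 2) / 2) * ‖∫ ω, φ ω * kerE α a b (ω - z)‖ := by
  have key : ∀ ω : ℂ, φ ω * nker α (z + b) ω *
      Complex.exp ((α : ℂ) * (z + a) * (starRingEnd ℂ) ω - ((α * ‖ω‖ ^ 2 : ℝ) : ℂ)) =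
      Complex.exp (α * (z * (starRingEnd ℂ) z + (starRingEnd ℂ) b * z + a * (starRingEnd ℂ) z)
        - ((α * ‖z + b‖ ^ 2 / 2 : ℝ) : ℂ)) * (φ ω * kerE α a b (ω - z)) := by
    intro ω
    unfold nker kerE
    rw [mul_assoc, ← Complex.exp_add, mul_left_comm, ← Complex.exp_add]
    congr 2
    push_cast
    simp only [← Complex.mul_conj', map_add, map_sub]
    ring
  unfold toeplitzC
  simp_rw [key]
  rw [integral_const_mul, norm_mul, norm_mul, Complex.norm_real, Real.norm_eq_abs, Complex.norm_exp]
  unfold gauss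
  have h2 : (α * (z * (starRingEnd ℂ) z + (starRingEnd ℂ) b * z + a * (starRingEnd ℂ) z)
        - ((α * ‖z + b‖ ^ 2 / 2 : ℝ) : ℂ)).re + (-α * ‖z + a‖ ^ 2 / 2)
        = -α * (‖a‖ ^ 2 + ‖b‖ ^ 2) / 2 := by
    simp only [Complex.sq_norm, Complex.normSq_apply]
    simp
    ring
  rw [← h2, Real.exp_add]
  ring

lemma J_tendsto (α : ℝ) (hα : 0 < α) (φ : ℂ → ℂ)
    (h : Tendsto (fun w => fockNormInf α (toeplitzC α φ (nker α w))) (cocompact ℂ) (𝓝 0)) (a b : ℂ) :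
    Tendsto (fun z => ∫ ω, φ ω * kerE α a b (ω - z)) (cocompact ℂ) (𝓝 0) := by
  have hb : Tendsto (fun z : ℂ => z + b) (cocompact ℂ) (cocompact ℂ) :=
    (Homeomorph.addRight b).isClosedEmbedding.tendsto_cocompact
  have h1 := h.comp hb
  have h2 : Tendsto (fun z => ‖toeplitzC α φ (nker α (z + b)) (z + a)‖ * gauss α (z + a))
      (cocompact ℂ) (𝓝 0) := by
    have h3 : Tendsto (fun z => ENNReal.ofReal (‖toeplitzC α φ (nker α (z + b)) (z + a)‖ * gauss α (z + a)))
      (cocompact ℂ) (𝓝 0) := by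
      refine tendsto_of_tendsto_of_tendsto_of_le_of_le tendsto_const_nhds h1 (fun _ => zero_le) ?_
      intro z
      exact le_iSup (fun x => ENNReal.ofReal (‖toeplitzC α φ (nker α (z + b)) x‖ * gauss α x)) (z + a)
    have h4 := (ENNReal.tendsto_toReal ENNReal.zero_ne_top).comp h3
    refine h4.congr fun z => ?_
    exact ENNReal.toReal_ofReal (mul_nonneg (norm_nonneg _) (Real.exp_pos _).le)
  simp_rw [toeplitz_eq] at h2
  have hc : |α / Real.pi| * Real.exp (-α * (‖a‖ ^ 2 + ‖b‖ ^ 2) / 2) ≠ 0 := by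
    have := Real.pi_pos
    positivity
  have h5 := h2.const_mul (|α / Real.pi| * Real.exp (-α * (‖a‖ ^ 2 + ‖b‖ ^ 2) / 2))⁻¹
  rw [tendsto_zero_iff_norm_tendsto_zero]
  rw [mul_zero] at h5
  refine h5.congr fun z => ?_
  rw [← mul_assoc, inv_mul_cancel₀ hc, one_mul]

lemma kerE_zero (α : ℝ) (φ : ℂ → ℂ) (z : ℂ) :
    berezinC α 2 φ z = ((α / Real.pi : ℝ) : ℂ) * ∫ ω, φ ω * kerE α 0 0 (ω - z) := by
  unfold berezinC kerE
  congr 2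
  ext ω
  rw [norm_sub_rev, Complex.ofReal_exp]
  congr 2
  push_cast
  simp

/-- Local bound from (I₁). -/
lemma local_bound (α : ℝ) (hα : 0 < α) (φ : ℂ → ℂ) (hmeas : Measurable φ) (hI : CondI1C α φ) (R : ℝ) :
    ∃ C : ℝ, ∀ z : ℂ, ‖z‖ ≤ R →
      ∫⁻ ω, ENNReal.ofReal (‖φ ω‖ * Real.exp (-α * ‖ω - z‖ ^ 2)) ≤ ENNReal.ofReal C := by
  let P : ℂ → ℂ → ℝ≥0∞ := fun p ω => ENNReal.ofReal (‖φ ω‖ *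
      Real.exp (2 * α * ((starRingEnd ℂ) p * ω).re - α * ‖ω‖ ^ 2))
  have hP : ∀ p, Measurable (P p) := by
    intro p
    simp only [P]
    have : Measurable (fun ω : ℂ => ((starRingEnd ℂ) p * ω).re) :=
      (Complex.continuous_re.comp (continuous_const.mul continuous_id)).measurable
    fun_prop
  set T : ℝ≥0∞ := (∫⁻ ω, P ⟨R, R⟩ ω) + (∫⁻ ω, P ⟨R, -R⟩ ω) + (∫⁻ ω, P ⟨-R, R⟩ ω) + (∫⁻ ω, P ⟨-R, -R⟩ ω) with hT
  have hTt : T ≠ ⊤ := by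
    simp only [hT, ne_eq, ENNReal.add_eq_top, not_or]
    exact ⟨⟨⟨(hI _).ne, (hI _).ne⟩, (hI _).ne⟩, (hI _).ne⟩
  refine ⟨T.toReal, fun z hz => ?_⟩
  rw [ENNReal.ofReal_toReal hTt, hT, ← lintegral_add_right _ (hP _),
    ← lintegral_add_right _ (hP _), ← lintegral_add_right _ (hP _)]
  refine lintegral_mono fun ω => ?_
  have hre : |z.re| ≤ R := (Complex.abs_re_le_norm z).trans hz
  have him : |z.im| ≤ R := (Complex.abs_im_le_norm z).trans hz
  have e1 : z.re * ω.re ≤ R * |ω.re| := by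
    calc _ ≤ |z.re * ω.re| := le_abs_self _
      _ = |z.re| * |ω.re| := abs_mul _ _
      _ ≤ _ := by gcongr
  have e2 : z.im * ω.im ≤ R * |ω.im| := by
    calc _ ≤ |z.im * ω.im| := le_abs_self _
      _ = |z.im| * |ω.im| := abs_mul _ _
      _ ≤ _ := by gcongr
  have gen : ∀ p : ℂ, z.re * ω.re + z.im * ω.im ≤ p.re * ω.re + p.im * ω.im →
      ENNReal.ofReal (‖φ ω‖ * Real.exp (-α * ‖ω - z‖ ^ 2)) ≤ P p ω := by
    intro p hp
    refine ENNReal.ofReal_le_ofReal (mul_le_mul_of_nonneg_left (Real.exp_le_exp.2 ?_) (norm_nonneg _))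
    simp only [Complex.sq_norm, Complex.normSq_apply]
    simp
    nlinarith [mul_nonneg hα.le (sub_nonneg.2 hp), mul_nonneg hα.le (add_nonneg (mul_self_nonneg z.re) (mul_self_nonneg z.im))]
  simp only [Pi.add_apply]
  rcases abs_cases ω.re with ⟨h1, -⟩ | ⟨h1, -⟩ <;> rcases abs_cases ω.im with ⟨h2, -⟩ | ⟨h2, -⟩ <;>
    rw [h1] at e1 <;> rw [h2] at e2
  · exact (gen ⟨R, R⟩ (by simp only; linarith)).trans (by rw [add_assoc, add_assoc]; exact le_self_add)
  · refine (gen ⟨R, -R⟩ (by simp only; linarith)).trans ?_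
    rw [add_assoc, add_assoc, add_left_comm]; exact le_self_add
  · refine (gen ⟨-R, R⟩ (by simp only; linarith)).trans ?_
    rw [add_right_comm]; exact le_add_self
  · exact (gen ⟨-R, -R⟩ (by simp only; linarith)).trans le_add_self

lemma gauss_int (α : ℝ) (hα : 0 < α) :
    Integrable (fun v : ℂ => Real.exp (-α * ‖v‖ ^ 2)) := by
  have := (GaussianFourier.integrable_cexp_neg_mul_sq_norm_add (V := ℂ) (b := (α : ℂ)) (by simpa using hα) 0 0).norm
  refine this.congr (Eventually.of_forall fun v => ?_)
  simp only [Complex.norm_exp]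
  congr 1
  simp [← Complex.ofReal_pow]

lemma global_bound (α : ℝ) (hα : 0 < α) (φ : ℂ → ℂ) (hmeas : Measurable φ) (hI : CondI1C α φ)
    (hBMO : FockBMOBound α φ) (h2 : Tendsto (fun z => berezinC α 2 φ z) (cocompact ℂ) (𝓝 0)) :
    ∃ C : ℝ, 0 ≤ C ∧ ∀ z : ℂ,
      ∫⁻ ω, ENNReal.ofReal (‖φ ω‖ * Real.exp (-α * ‖ω - z‖ ^ 2)) ≤ ENNReal.ofReal C := by
  obtain ⟨B, hB⟩ := hBMO
  have hev : ∀ᶠ z in cocompact ℂ, ‖berezinC α 2 φ z‖ < 1 := by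
    have := h2.norm
    rw [norm_zero] at this
    exact this.eventually_lt_const one_pos
  obtain ⟨R, hR⟩ : ∃ R : ℝ, ∀ z : ℂ, R < ‖z‖ → ‖berezinC α 2 φ z‖ < 1 := by
    rw [← Metric.cobounded_eq_cocompact] at hev
    obtain ⟨R, -, hR⟩ := (Metric.hasBasis_cobounded_compl_closedBall (0:ℂ)).eventually_iff.1 hev
    exact ⟨R, fun z hz => hR (by simpa using hz)⟩
  obtain ⟨C₁, hC₁⟩ := local_bound α hα φ hmeas hI R
  set G : ℝ≥0∞ := ∫⁻ ω : ℂ, ENNReal.ofReal (Real.exp (-α * ‖ω‖ ^ 2)) with hG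
  have hGt : G ≠ ⊤ := by
    have := (gauss_int α hα).lintegral_lt_top
    exact this.ne
  have hc : 0 < α / Real.pi := div_pos hα Real.pi_pos
  set C₂ : ℝ≥0∞ := ENNReal.ofReal (α / Real.pi)⁻¹ * ENNReal.ofReal B + G with hC2
  have hC₂ : C₂ ≠ ⊤ := by
    rw [hC2]; exact ENNReal.add_ne_top.2 ⟨ENNReal.mul_ne_top ENNReal.ofReal_ne_top ENNReal.ofReal_ne_top, hGt⟩
  refine ⟨max 0 (max C₁ C₂.toReal), le_max_left _ _, fun z => ?_⟩
  by_cases hz : ‖z‖ ≤ R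
  · exact (hC₁ z hz).trans (ENNReal.ofReal_le_ofReal ((le_max_left _ _).trans (le_max_right _ _)))
  · push Not at hz
    refine le_trans ?_ (ENNReal.ofReal_le_ofReal ((le_max_right C₁ C₂.toReal).trans (le_max_right _ _)))
    rw [ENNReal.ofReal_toReal hC₂]
    have hsub : ∫⁻ ω, ENNReal.ofReal (‖φ ω‖ * Real.exp (-α * ‖ω - z‖ ^ 2)) =
        ∫⁻ ω, ENNReal.ofReal (‖φ (z - ω)‖ * Real.exp (-α * ‖ω‖ ^ 2)) := by
      rw [← lintegral_sub_left_eq_self (fun ω => ENNReal.ofReal (‖φ ω‖ * Real.exp (-α * ‖ω - z‖ ^ 2))) z]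
      congr 1
      ext ω
      rw [sub_sub_cancel_left, norm_neg]
    rw [hsub, hC2]
    calc ∫⁻ ω, ENNReal.ofReal (‖φ (z - ω)‖ * Real.exp (-α * ‖ω‖ ^ 2))
        ≤ ∫⁻ ω, (ENNReal.ofReal (α / Real.pi)⁻¹ * ENNReal.ofReal (α / Real.pi * Real.exp (-α * ‖ω‖ ^ 2) *
        ‖φ (z - ω) - berezinC α 2 φ z‖) + ENNReal.ofReal (Real.exp (-α * ‖ω‖ ^ 2))) := by
          refine lintegral_mono fun ω => ?_
          simp only
          rw [← ENNReal.ofReal_mul (by positivity), ← ENNReal.ofReal_add (by positivity) (by positivity)]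
          refine ENNReal.ofReal_le_ofReal ?_
          rw [mul_assoc (α / Real.pi), inv_mul_cancel_left₀ hc.ne']
          have h3 : ‖φ (z - ω)‖ ≤ ‖φ (z - ω) - berezinC α 2 φ z‖ + 1 := by
            have := norm_le_norm_sub_add (φ (z - ω)) (berezinC α 2 φ z)
            have := hR z hz
            linarith
          have := mul_le_mul_of_nonneg_right h3 (Real.exp_pos (-α * ‖ω‖ ^ 2)).le
          linarith
      _ = ENNReal.ofReal (α / Real.pi)⁻¹ * (∫⁻ ω, ENNReal.ofReal (α / Real.pi * Real.exp (-α * ‖ω‖ ^ 2) *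
        ‖φ (z - ω) - berezinC α 2 φ z‖)) + G := by
          rw [lintegral_add_right _ (by fun_prop), lintegral_const_mul' _ _ ENNReal.ofReal_ne_top]
      _ ≤ _ := by gcongr; exact hB z

/-- Gaussian integral identity. -/
lemma gauss_integral (α c σ : ℝ) (hc : 0 < c) (hσ : σ = 1 ∨ σ = -1) (v : ℂ) :
    ∫ a : ℂ, kerE α a (σ * a) v * ((Real.exp (-c * ‖a‖ ^ 2) : ℝ) : ℂ) =
      ((Real.pi / c : ℝ) : ℂ) * ((Real.exp (-(α - σ * α ^ 2 / c) * ‖v‖ ^ 2) : ℝ) : ℂ) := by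
  have main : ∀ (κ : ℂ) (w : ℂ), ‖w‖ = ‖v‖ → κ ^ 2 = 4 * σ * α ^ 2 →
      (∀ a : ℂ, (α : ℂ) * ((σ * (starRingEnd ℂ) a) * v + a * (starRingEnd ℂ) v) = κ * (inner ℝ w a : ℝ)) →
      ∫ a : ℂ, kerE α a (σ * a) v * ((Real.exp (-c * ‖a‖ ^ 2) : ℝ) : ℂ) =
      ((Real.pi / c : ℝ) : ℂ) * ((Real.exp (-(α - σ * α ^ 2 / c) * ‖v‖ ^ 2) : ℝ) : ℂ) := by
    intro κ w hw hκ h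
    have h1 := GaussianFourier.integral_cexp_neg_mul_sq_norm_add (V := ℂ) (b := (c : ℂ)) (by simpa using hc) κ w
    have h2 : ∀ a : ℂ, kerE α a (σ * a) v * ((Real.exp (-c * ‖a‖ ^ 2) : ℝ) : ℂ) =
        Complex.exp (-((α * ‖v‖ ^ 2 : ℝ) : ℂ)) * Complex.exp (-(c : ℂ) * ‖a‖ ^ 2 + κ * (inner ℝ w a : ℝ)) := by
      intro a
      unfold kerE
      rw [Complex.ofReal_exp, ← Complex.exp_add, ← Complex.exp_add, ← h a]
      congr 1
      push_cast
      simp only [map_mul, Complex.conj_ofReal]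
      ring
    simp_rw [h2]
    have hc' : (c : ℂ) ≠ 0 := by exact_mod_cast hc.ne'
    rw [integral_const_mul, h1, Complex.finrank_real_complex, hw, hκ]
    have : ((2 : ℕ) / 2 : ℂ) = 1 := by norm_num
    rw [this, Complex.cpow_one, mul_left_comm, ← Complex.exp_add, Complex.ofReal_exp]
    push_cast
    congr 2
    field_simp
    ring
  rcases hσ with rfl | rfl
  · refine main (2 * α) v rfl (by push_cast; ring) fun a => ?_
    rw [Complex.inner]
    apply Complex.ext <;> simp [-mul_eq_mul_left_iff] <;> first | ring1 | (right; ring1)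
  · refine main (2 * α * Complex.I) (Complex.I * v) (by simp) (by push_cast; ring_nf; simp) fun a => ?_
    rw [Complex.inner]
    apply Complex.ext <;> simp [-mul_eq_mul_left_iff] <;> first | ring1 | (right; ring1)

lemma main_case (α : ℝ) (hα : 0 < α) (φ : ℂ → ℂ) (hmeas : Measurable φ) (C : ℝ) (hC0 : 0 ≤ C)
    (hC : ∀ z : ℂ, ∫⁻ ω, ENNReal.ofReal (‖φ ω‖ * Real.exp (-α * ‖ω - z‖ ^ 2)) ≤ ENNReal.ofReal C)
    (hJ : ∀ a b, Tendsto (fun z => ∫ ω, φ ω * kerE α a b (ω - z)) (cocompact ℂ) (𝓝 0))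
    (c σ : ℝ) (hc : 0 < c) (hσ : σ = 1 ∨ σ = -1) (hcσ : α * ((1 + σ) / 2) ^ 2 < c) (t : ℝ)
    (ht : α * t / 2 = α - σ * α ^ 2 / c) :
    Tendsto (fun z => berezinC α t φ z) (cocompact ℂ) (𝓝 0) := by
  set d := c - α * ((1 + σ) / 2) ^ 2 with hd
  have hd0 : 0 < d := sub_pos.2 hcσ
  let F : ℂ → ℂ → ℂ → ℂ := fun z ω a =>
    φ ω * (kerE α a (σ * a) (ω - z) * ((Real.exp (-c * ‖a‖ ^ 2) : ℝ) : ℂ))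
  have hFn : ∀ z a ω, ‖F z ω a‖ₑ = ENNReal.ofReal (Real.exp (-d * ‖a‖ ^ 2)) *
      ENNReal.ofReal (‖φ ω‖ * Real.exp (-α * ‖ω - (z + (a + σ * a) / 2)‖ ^ 2)) := by
    intro z a ω
    rw [← ofReal_norm, ← ENNReal.ofReal_mul (Real.exp_pos _).le]
    congr 1
    simp only [F]
    rw [norm_mul, norm_mul, norm_kerE, Complex.norm_real, Real.norm_eq_abs, Real.abs_exp]
    have : -d * ‖a‖ ^ 2 = α * ‖(a + σ * a) / 2‖ ^ 2 + -c * ‖a‖ ^ 2 := by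
      have h1 : (a + σ * a) / 2 = (((1 + σ) / 2 : ℝ) : ℂ) * a := by push_cast; ring
      rw [h1, norm_mul, Complex.norm_real, mul_pow, Real.norm_eq_abs, sq_abs, hd]
      ring
    rw [this, Real.exp_add, sub_sub]
    ring
  have hFb : ∀ z a, ∫⁻ ω, ‖F z ω a‖ₑ ≤ ENNReal.ofReal (C * Real.exp (-d * ‖a‖ ^ 2)) := by
    intro z a
    simp_rw [hFn]
    rw [lintegral_const_mul' _ _ ENNReal.ofReal_ne_top, mul_comm C, ENNReal.ofReal_mul (Real.exp_pos _).le]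
    gcongr
    exact hC _
  have hbi : Integrable (fun a : ℂ => C * Real.exp (-d * ‖a‖ ^ 2)) := (gauss_int d hd0).const_mul C
  have hFm : ∀ z, Measurable (Function.uncurry (F z)) := by
    intro z
    have h1 : Continuous (fun p : ℂ × ℂ => kerE α p.2 (σ * p.2) (p.1 - z) * ((Real.exp (-c * ‖p.2‖ ^ 2) : ℝ) : ℂ)) := by
      unfold kerE
      have := Complex.continuous_conj
      fun_prop
    exact (hmeas.comp measurable_fst).mul h1.measurable
  have hFi : ∀ z, Integrable (Function.uncurry (F z)) (volume.prod volume) := by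
    intro z
    refine ⟨(hFm z).aestronglyMeasurable, ?_⟩
    unfold HasFiniteIntegral
    rw [lintegral_prod_symm' _ (hFm z).enorm]
    exact (lintegral_mono (hFb z)).trans_lt hbi.lintegral_lt_top
  have hrep : ∀ z, berezinC α t φ z = ((α / Real.pi : ℝ) : ℂ) * (((Real.pi / c : ℝ) : ℂ)⁻¹ *
      ∫ a, ∫ ω, F z ω a) := by
    intro z
    rw [← integral_integral_swap (hFi z)]
    simp only [F]
    simp_rw [integral_const_mul, gauss_integral α c σ hc hσ]
    rw [← integral_const_mul]
    unfold berezinC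
    congr 2
    ext ω
    have : ((Real.pi / c : ℝ) : ℂ) ≠ 0 := by
      exact_mod_cast (div_pos Real.pi_pos hc).ne'
    rw [mul_left_comm (φ ω), inv_mul_cancel_left₀ this, ht, norm_sub_rev]
  have hlim : Tendsto (fun z => ∫ a, ∫ ω, F z ω a) (cocompact ℂ) (𝓝 (∫ a : ℂ, (0 : ℂ))) := by
    refine tendsto_integral_filter_of_dominated_convergence _ ?_ ?_ hbi ?_
    · exact Eventually.of_forall fun z => (hFi z).integral_prod_right.aestronglyMeasurable
    · refine Eventually.of_forall fun z => Eventually.of_forall fun a => ?_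
      have h1 := (enorm_integral_le_lintegral_enorm (fun ω => F z ω a)).trans (hFb z a)
      rw [← ofReal_norm] at h1
      exact (ENNReal.ofReal_le_ofReal_iff (by positivity)).1 h1
    · refine Eventually.of_forall fun a => ?_
      have h1 := (hJ a (σ * a)).mul_const (((Real.exp (-c * ‖a‖ ^ 2) : ℝ) : ℂ))
      rw [zero_mul] at h1
      refine h1.congr fun z => ?_
      rw [← integral_mul_const]
      simp only [F, mul_assoc]
  rw [integral_zero] at hlim
  have := (hlim.const_mul (((Real.pi / c : ℝ) : ℂ)⁻¹)).const_mul ((α / Real.pi : ℝ) : ℂ)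
  rw [mul_zero, mul_zero] at this
  exact this.congr fun z => (hrep z).symm

/-- For measurable `φ` satisfying condition (I₁) and the Fock-BMO bound, if `T_φ` is
compact on `F_α^∞` then for every `t > 0` the `t`-Berezin transform `φ̃_t` vanishes at infinity. -/
theorem stmt17 (α : ℝ) (hα : 0 < α) (φ : ℂ → ℂ) (hmeas : Measurable φ)
    (hI : CondI1C α φ) (hBMO : FockBMOBound α φ)
    (hcompact : ∀ f : ℕ → ℂ → ℂ, (∀ n, MemFockInf α (f n)) →
      (∃ M : ℝ, ∀ n, fockNormInf α (f n) ≤ ENNReal.ofReal M) →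
      (∀ K : Set ℂ, IsCompact K → TendstoUniformlyOn (fun n => f n) (fun _ => 0) atTop K) →
      Tendsto (fun n => fockNormInf α (toeplitzC α φ (f n))) atTop (𝓝 0)) :
    ∀ t : ℝ, 0 < t → Tendsto (fun z => berezinC α t φ z) (cocompact ℂ) (𝓝 0) := by
  have hT := toeplitz_nker_tendsto α hα φ hcompact
  have hJ := fun a b => J_tendsto α hα φ hT a b
  have h2 : Tendsto (fun z => berezinC α 2 φ z) (cocompact ℂ) (𝓝 0) := by
    simp_rw [kerE_zero]
    simpa using (hJ 0 0).const_mul ((α / Real.pi : ℝ) : ℂ)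
  obtain ⟨C, hC0, hC⟩ := global_bound α hα φ hmeas hI hBMO h2
  intro t ht
  rcases lt_trichotomy t 2 with h | rfl | h
  · have h3 : 0 < 1 - t / 2 := by linarith
    refine main_case α hα φ hmeas C hC0 hC hJ (α / (1 - t / 2)) 1 (by positivity) (Or.inl rfl) ?_ t ?_
    · rw [lt_div_iff₀ h3]
      nlinarith
    · field_simp
      ring
  · exact h2
  · have h3 : 0 < t / 2 - 1 := by linarith
    refine main_case α hα φ hmeas C hC0 hC hJ (α / (t / 2 - 1)) (-1) (by positivity) (Or.inr rfl) ?_ t ?_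
    · norm_num
      positivity
    · field_simp
      ring
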